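/- Let d ≥ 2 and let W ∈ Matrix (Fin d × Fin d) (Fin d × Fin d) ℂ be Hermitian (Wᴴ = W) such that (1 ⊗ R⁻¹)W is positive semidefinite. Then for all unit vectors ψ, φ ∈ ℂ^d, 0 ≤ Re(trace(W · (|ψ⟩⟨ψ| ⊗ₖ |φ⟩⟨φ|))); in particular, if moreover W is not positive semidefinite, W is an entanglement witness. -/

import Mathlib

open Matrix Kronecker ComplexOrder

/-- The inverse reduction map `R⁻¹(A) = (trace A / (d-1)) • 1 - A`. -/
noncomputable def Rinv (d : ℕ) (A : Matrix (Fin d) (Fin d) ℂ) : Matrix (Fin d) (Fin d) ℂ :=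
  (A.trace / ((d : ℂ) - 1)) • (1 : Matrix (Fin d) (Fin d) ℂ) - A

/-- The map `1 ⊗ Λ` acting on `Matrix (Fin d × Fin d) (Fin d × Fin d) ℂ`, defined
entrywise by `((1 ⊗ Λ) M) ((i,k),(j,l)) = (Λ M⁽ⁱʲ⁾) (k,l)` where
`M⁽ⁱʲ⁾ (k,l) = M ((i,k),(j,l))`. -/
noncomputable def oneTensor {d : ℕ}
    (Λ : Matrix (Fin d) (Fin d) ℂ → Matrix (Fin d) (Fin d) ℂ)
    (M : Matrix (Fin d × Fin d) (Fin d × Fin d) ℂ) :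
    Matrix (Fin d × Fin d) (Fin d × Fin d) ℂ :=
  Matrix.of fun p q => Λ (Matrix.of fun k l => M (p.1, k) (q.1, l)) p.2 q.2


lemma expect_le_trace {d : ℕ} (C : Matrix (Fin d) (Fin d) ℂ) (hC : C.PosSemidef)
    (φ : Fin d → ℂ) (hφ : star φ ⬝ᵥ φ = 1) :
    0 ≤ C.trace - (C * vecMulVec φ (star φ)).trace := by
  set Φ := vecMulVec φ (star φ) with hΦ
  have hH : Φᴴ = Φ := by
    rw [hΦ, conjTranspose_vecMulVec, star_star]
  have hI : Φ * Φ = Φ := by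
    rw [hΦ, vecMulVec_mul_vecMulVec, hφ]; simp
  have h := (hC.mul_mul_conjTranspose_same (1 - Φ)).trace_nonneg
  have e : ((1 - Φ) * C * (1 - Φ)ᴴ).trace = C.trace - (C * Φ).trace := by
    rw [Matrix.trace_mul_comm, ← Matrix.mul_assoc, Matrix.trace_mul_comm, conjTranspose_sub, hH,
      conjTranspose_one]
    have : (1 - Φ) * (1 - Φ) = 1 - Φ := by
      simp [sub_mul, mul_sub, hI]
    rw [this, mul_sub, mul_one, trace_sub]
  rwa [e] at h

noncomputable def emb {d : ℕ} (ψ : Fin d → ℂ) : Matrix (Fin d × Fin d) (Fin d) ℂ :=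
  Matrix.of fun p l => ψ p.1 * (1 : Matrix (Fin d) (Fin d) ℂ) p.2 l

lemma emb_apply {d : ℕ} (ψ : Fin d → ℂ) (M : Matrix (Fin d × Fin d) (Fin d × Fin d) ℂ)
    (k l : Fin d) : ((emb ψ)ᴴ * M * emb ψ) k l
      = ∑ j, ∑ i, star (ψ i) * M (i, k) (j, l) * ψ j := by
  simp [Matrix.mul_apply, emb, Fintype.sum_prod_type, Matrix.one_apply, apply_ite, Finset.sum_mul]

lemma emb_kron {d : ℕ} (ψ : Fin d → ℂ) (Φ : Matrix (Fin d) (Fin d) ℂ) :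
    emb ψ * Φ * (emb ψ)ᴴ = vecMulVec ψ (star ψ) ⊗ₖ Φ := by
  ext ⟨i, k⟩ ⟨j, l⟩
  simp [Matrix.mul_apply, emb, Matrix.one_apply, apply_ite, vecMulVec_apply]
  ring

lemma emb_Rinv {d : ℕ} (ψ : Fin d → ℂ) (W : Matrix (Fin d × Fin d) (Fin d × Fin d) ℂ) :
    (emb ψ)ᴴ * oneTensor (Rinv d) W * emb ψ = Rinv d ((emb ψ)ᴴ * W * emb ψ) := by
  ext k l
  have ht : ((emb ψ)ᴴ * W * emb ψ).trace
      = ∑ j, ∑ i, star (ψ i) * (∑ k, W (i, k) (j, k)) * ψ j := by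
    simp only [Matrix.trace, Matrix.diag, emb_apply, Finset.mul_sum, Finset.sum_mul]
    rw [Finset.sum_comm]
    refine Finset.sum_congr rfl fun j _ => ?_
    rw [Finset.sum_comm]
  rw [emb_apply, Rinv, ht, Matrix.sub_apply, emb_apply, Matrix.smul_apply, smul_eq_mul,
    Finset.sum_div, Finset.sum_mul, ← Finset.sum_sub_distrib]
  refine Finset.sum_congr rfl fun j _ => ?_
  rw [Finset.sum_div, Finset.sum_mul, ← Finset.sum_sub_distrib]
  refine Finset.sum_congr rfl fun i _ => ?_
  simp only [oneTensor, Rinv, Matrix.of_apply, Matrix.sub_apply, Matrix.smul_apply, smul_eq_mul,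
    Matrix.trace, Matrix.diag]
  ring

/-- If `W` is Hermitian and `(1 ⊗ R⁻¹) W` is positive semidefinite, then `W` has
nonnegative expectation value on every product state; in particular if `W` is not
positive semidefinite, it is an entanglement witness. -/
theorem entanglement_witness_from_inverse_reduction (d : ℕ) (hd : 2 ≤ d)
    (W : Matrix (Fin d × Fin d) (Fin d × Fin d) ℂ) (hW : Wᴴ = W)
    (hpos : (oneTensor (Rinv d) W).PosSemidef) :
    (∀ ψ φ : Fin d → ℂ, star ψ ⬝ᵥ ψ = 1 → star φ ⬝ᵥ φ = 1 →
      0 ≤ (Matrix.trace (W * (vecMulVec ψ (star ψ) ⊗ₖ vecMulVec φ (star φ)))).re) ∧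
    (¬ W.PosSemidef →
      (Wᴴ = W ∧ ¬ W.PosSemidef ∧
        ∀ ψ φ : Fin d → ℂ, star ψ ⬝ᵥ ψ = 1 → star φ ⬝ᵥ φ = 1 →
          0 ≤ (Matrix.trace (W * (vecMulVec ψ (star ψ) ⊗ₖ vecMulVec φ (star φ)))).re)) := by
  have main : ∀ ψ φ : Fin d → ℂ, star ψ ⬝ᵥ ψ = 1 → star φ ⬝ᵥ φ = 1 →
      0 ≤ (Matrix.trace (W * (vecMulVec ψ (star ψ) ⊗ₖ vecMulVec φ (star φ)))).re := by
    intro ψ φ _ hφ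
    have hC := hpos.conjTranspose_mul_mul_same (emb ψ)
    rw [emb_Rinv] at hC
    have key := expect_le_trace _ hC φ hφ
    have e : Matrix.trace (W * (vecMulVec ψ (star ψ) ⊗ₖ vecMulVec φ (star φ)))
        = (((emb ψ)ᴴ * W * emb ψ) * vecMulVec φ (star φ)).trace := by
      rw [← emb_kron, ← Matrix.mul_assoc, Matrix.trace_mul_comm]
      simp only [Matrix.mul_assoc]
    rw [e]
    set B := (emb ψ)ᴴ * W * emb ψ
    have hd1 : (d : ℂ) - 1 ≠ 0 := by
      rw [sub_ne_zero]
      exact_mod_cast (by omega : d ≠ 1)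
    have hφt : (vecMulVec φ (star φ)).trace = 1 := by
      rw [trace_vecMulVec, dotProduct_comm, hφ]
    have e2 : (Rinv d B).trace - (Rinv d B * vecMulVec φ (star φ)).trace
        = (B * vecMulVec φ (star φ)).trace := by
      simp only [Rinv, sub_mul, trace_sub, trace_smul, Matrix.smul_mul, Matrix.one_mul, hφt,
        trace_one, Fintype.card_fin, smul_eq_mul]
      field_simp
      ring
    rw [e2] at key
    exact (Complex.le_def.mp key).1
  exact ⟨main, fun h => ⟨hW, h, main⟩⟩
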